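/- Let K/F be a cyclic Galois field extension of degree m with Gal(K/F) = ⟨σ⟩, and suppose either m = 2, or m = 3, or m ≥ 5 is prime and F contains a primitive mth root of unity. Then for every a ∈ K ∖ F, the nonassociative cyclic algebra (K/F, σ, a) is a division algebra. -/

import Mathlib

/-- The multiplication of the nonassociative cyclic algebra
`(K/F,σ,a) = K[t;σ]/K[t;σ](t^m - a)`, on the `F`-vector space `Fin m → K`
(coordinates with respect to the `K`-basis `t^0, …, t^{m-1}`). -/
noncomputable def petitMul {F K : Type*} [Field F] [Field K] [Algebra F K]
    (σ : K ≃ₐ[F] K) (a : K) (m : ℕ) (x y : Fin m → K) : Fin m → K :=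
  fun l =>
    (∑ i : Fin m, ∑ j : Fin m,
      if (i : ℕ) + (j : ℕ) = (l : ℕ) then x i * (σ ^ (i : ℕ)) (y j) else 0)
    + (∑ i : Fin m, ∑ j : Fin m,
      if (i : ℕ) + (j : ℕ) = (l : ℕ) + m then
        x i * (σ ^ (i : ℕ)) (y j) * (σ ^ (l : ℕ)) a else 0)

/-- Left multiplication by `t` on `K[t;σ]/K[t;σ](t^m - a)`, in the basis `t^0, …, t^{m-1}`. -/
noncomputable def petitShift {F K : Type*} [Field F] [Field K] [Algebra F K]
    (σ : K ≃ₐ[F] K) (a : K) (m : ℕ) [NeZero m] :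
    (Fin m → K) →ₛₗ[(σ : K →+* K)] (Fin m → K) where
  toFun y l := (if l = 0 then a else 1) * σ (y (l - 1))
  map_add' y z := by
    ext l
    simp [mul_add]
  map_smul' c y := by
    ext l
    simp [mul_left_comm]

theorem petitShift_apply {F K : Type*} [Field F] [Field K] [Algebra F K]
    (σ : K ≃ₐ[F] K) (a : K) (m : ℕ) [NeZero m] (y : Fin m → K) (l : Fin m) :
    petitShift σ a m y l = (if l = 0 then a else 1) * σ (y (l - 1)) := rfl

theorem Fin.val_zero_sub_one {m : ℕ} [NeZero m] : ((0 - 1 : Fin m) : ℕ) = m - 1 := by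
  obtain ⟨n, rfl⟩ := Nat.exists_eq_succ_of_ne_zero (NeZero.ne m)
  simp

theorem petitShift_iterate_apply {F K : Type*} [Field F] [Field K] [Algebra F K]
    (σ : K ≃ₐ[F] K) (a : K) (m : ℕ) [NeZero m] (y : Fin m → K) (i : ℕ) (hi : i ≤ m)
    (l : Fin m) :
    (petitShift σ a m)^[i] y l =
      (if (l : ℕ) < i then (σ ^ (l : ℕ)) a else 1) * (σ ^ i) (y (l - Fin.ofNat m i)) := by
  induction i generalizing l with
  | zero => simp
  | succ i ih =>
    have hsub : l - 1 - Fin.ofNat m i = l - Fin.ofNat m (i + 1) := by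
      have : Fin.ofNat m (i + 1) = Fin.ofNat m i + 1 := by
        apply Fin.ext
        simp [Fin.val_add]
      rw [this]
      abel
    rw [Function.iterate_succ_apply', petitShift_apply, ih (by omega), hsub, map_mul,
      ← AlgEquiv.mul_apply, ← pow_succ']
    by_cases hl : l = 0
    · subst hl
      have h : ¬ ((0 - 1 : Fin m) : ℕ) < i := by rw [Fin.val_zero_sub_one]; omega
      rw [if_neg h]
      simp
    · have hv : ((l - 1 : Fin m) : ℕ) = l - 1 := Fin.val_sub_one_of_ne_zero hl
      have hl' : (l : ℕ) ≠ 0 := fun h => hl (Fin.ext (by simpa using h))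
      rw [hv, if_neg hl, one_mul]
      by_cases h : (l : ℕ) < i + 1
      · rw [if_pos (by omega), if_pos h, ← AlgEquiv.mul_apply, ← pow_succ',
          Nat.sub_add_cancel (by omega)]
      · rw [if_neg (by omega), if_neg h, map_one]

theorem petitMul_eq_sum_petitShift_iterate {F K : Type*} [Field F] [Field K] [Algebra F K]
    (σ : K ≃ₐ[F] K) (a : K) (m : ℕ) [NeZero m] (x y : Fin m → K) :
    petitMul σ a m x y = ∑ i : Fin m, x i • (petitShift σ a m)^[i] y := by
  ext l
  simp only [petitMul, Finset.sum_apply, Pi.smul_apply, smul_eq_mul]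
  rw [← Finset.sum_add_distrib]
  refine Finset.sum_congr rfl fun i _ => ?_
  rw [petitShift_iterate_apply σ a m y i i.isLt.le, Fin.ofNat_eq_cast, Fin.cast_val_eq_self]
  have hl := l.isLt
  have hi := i.isLt
  by_cases h : (l : ℕ) < i
  · have h1 : ∀ j : Fin m, ¬ (i : ℕ) + j = l := fun j => by omega
    have hv : ((l - i : Fin m) : ℕ) = m + l - i := by
      rw [Fin.coe_sub_iff_lt.2 h]
    have h2 : ∀ j : Fin m, (i : ℕ) + j = l + m ↔ l - i = j := fun j => by
      rw [Fin.ext_iff, hv]; omega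
    simp only [h1, h2, if_false, Finset.sum_const_zero, Finset.sum_ite_eq, Finset.mem_univ,
      if_true, h, zero_add]
    ring
  · have h1 : ∀ j : Fin m, ¬ (i : ℕ) + j = l + m := fun j => by omega
    have hv : ((l - i : Fin m) : ℕ) = l - i := Fin.coe_sub_iff_le.2 (not_lt.1 h)
    have h2 : ∀ j : Fin m, (i : ℕ) + j = l ↔ l - i = j := fun j => by
      rw [Fin.ext_iff, hv]; omega
    simp only [h1, h2, if_false, Finset.sum_const_zero, Finset.sum_ite_eq, Finset.mem_univ,
      if_true, h, add_zero, one_mul]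

/-- A nonzero subspace invariant under a diagonal map with distinct entries contains a standard
basis vector. -/
theorem Submodule.exists_single_mem_of_diagonal_invariant {ι K : Type*} [Fintype ι]
    [DecidableEq ι] [Field K] (W : Submodule K (ι → K)) (d : ι → K)
    (hd : Function.Injective d) (hW : ∀ w ∈ W, d * w ∈ W) (hne : W ≠ ⊥) :
    ∃ l, Pi.single l 1 ∈ W := by
  obtain ⟨w, hw, hw0⟩ := W.ne_bot_iff.1 hne
  obtain ⟨l, hl⟩ := Function.ne_iff.1 hw0
  have key : ∀ s : Finset ι, (fun k => (∏ j ∈ s, (d k - d j)) * w k) ∈ W := by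
    intro s
    induction s using Finset.induction_on with
    | empty => simpa using hw
    | insert j s hj ih =>
      convert W.sub_mem (hW _ ih) (W.smul_mem (d j) ih) using 1
      ext k
      simp only [Finset.prod_insert hj, Pi.sub_apply, Pi.mul_apply, Pi.smul_apply, smul_eq_mul]
      ring
  set c := (∏ j ∈ Finset.univ.erase l, (d l - d j)) * w l with hc
  have hc0 : c ≠ 0 := mul_ne_zero (Finset.prod_ne_zero_iff.2 fun j hj =>
    sub_ne_zero.2 fun h => Finset.ne_of_mem_erase hj (hd h).symm) hl
  refine ⟨l, ?_⟩
  convert W.smul_mem c⁻¹ (key (Finset.univ.erase l)) using 1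
  ext k
  by_cases hk : k = l
  · subst hk
    simp [← hc, hc0]
  · rw [Pi.single_eq_of_ne hk, Pi.smul_apply,
      Finset.prod_eq_zero (Finset.mem_erase.2 ⟨hk, Finset.mem_univ k⟩) (sub_self _)]
    simp

/-- The module `K[t;σ]/K[t;σ](t^m - a)` is simple if the conjugates `σ^l a` are distinct. -/
theorem eq_top_of_petitShift_invariant {F K : Type*} [Field F] [Field K] [Algebra F K]
    (σ : K ≃ₐ[F] K) (a : K) (ha : a ≠ 0) (m : ℕ) [NeZero m] (hσ : σ ^ m = 1)
    (hinj : Function.Injective fun l : Fin m => (σ ^ (l : ℕ)) a)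
    (W : Submodule K (Fin m → K)) (hW : ∀ w ∈ W, petitShift σ a m w ∈ W) (hne : W ≠ ⊥) :
    W = ⊤ := by
  have hiter : ∀ (i : ℕ), ∀ w ∈ W, (petitShift σ a m)^[i] w ∈ W := fun i w hw => by
    induction i with
    | zero => exact hw
    | succ i ih => rw [Function.iterate_succ_apply']; exact hW _ ih
  obtain ⟨l, hl⟩ := W.exists_single_mem_of_diagonal_invariant _ hinj (fun w hw => by
    convert hiter m w hw using 1
    ext k
    rw [petitShift_iterate_apply σ a m w m le_rfl, if_pos k.isLt, hσ]
    simp) hne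
  have hsucc : ∀ k : Fin m, Pi.single k 1 ∈ W → Pi.single (k + 1) 1 ∈ W := fun k hk => by
    have hc : (if k + 1 = 0 then a else 1) ≠ 0 := by split_ifs <;> simp [ha]
    convert W.smul_mem (if k + 1 = 0 then a else 1)⁻¹ (hW _ hk) using 1
    ext j
    rw [Pi.smul_apply, petitShift_apply, smul_eq_mul]
    by_cases hj : j = k + 1
    · subst hj
      rw [add_sub_cancel_right, Pi.single_eq_same, Pi.single_eq_same, map_one, mul_one,
        inv_mul_cancel₀ hc]
    · rw [Pi.single_eq_of_ne hj, Pi.single_eq_of_ne (fun h => hj (by rw [← h]; abel))]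
      simp
  have hadd : ∀ n : ℕ, Pi.single (l + Fin.ofNat m n) 1 ∈ W := fun n => by
    induction n with
    | zero => simpa using hl
    | succ n ih =>
      convert hsucc _ ih using 2
      apply Fin.ext
      simp [Fin.val_add, add_assoc]
  have hall : ∀ k : Fin m, Pi.single k (1 : K) ∈ W := fun k => by
    convert hadd (k - l : Fin m) using 2
    rw [Fin.ofNat_eq_cast, Fin.cast_val_eq_self]
    abel
  rw [eq_top_iff, ← (Pi.basisFun K (Fin m)).span_eq, Submodule.span_le]
  rintro _ ⟨k, rfl⟩
  simpa using hall k

theorem petitMul_eq_zero_of_injective {F K : Type*} [Field F] [Field K] [Algebra F K]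
    (σ : K ≃ₐ[F] K) (a : K) (ha : a ≠ 0) (m : ℕ) [NeZero m] (hσ : σ ^ m = 1)
    (hinj : Function.Injective fun l : Fin m => (σ ^ (l : ℕ)) a)
    (x y : Fin m → K) (hxy : petitMul σ a m x y = 0) : x = 0 ∨ y = 0 := by
  by_contra! h
  obtain ⟨hx, hy⟩ := h
  set T := petitShift σ a m
  obtain ⟨r, hr, hmax⟩ : ∃ r, x r ≠ 0 ∧ ∀ i, r < i → x i = 0 := by
    classical
    have hne : (Finset.univ.filter fun i => x i ≠ 0).Nonempty := by
      obtain ⟨i, hi⟩ := Function.ne_iff.1 hx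
      exact ⟨i, by simpa using hi⟩
    refine ⟨_, (Finset.mem_filter.1 (Finset.max'_mem _ hne)).2, fun i hi => ?_⟩
    by_contra h0
    exact absurd (Finset.le_max' _ i (by simpa using h0)) (not_le.2 hi)
  set W := Submodule.span K (Set.range fun i : Fin r => T^[i] y) with hWdef
  have hmem : ∀ i : ℕ, i < r → T^[i] y ∈ W := fun i hi => Submodule.subset_span ⟨⟨i, hi⟩, rfl⟩
  have hrW : T^[r] y ∈ W := by
    rw [petitMul_eq_sum_petitShift_iterate, ← Finset.add_sum_erase _ _ (Finset.mem_univ r),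
      add_eq_zero_iff_eq_neg] at hxy
    refine (W.smul_mem_iff hr).1 (hxy ▸ W.neg_mem (W.sum_mem fun i hi => ?_))
    rcases lt_or_gt_of_ne (Finset.ne_of_mem_erase hi) with h | h
    · exact W.smul_mem _ (hmem i h)
    · rw [hmax i h, zero_smul]
      exact W.zero_mem
  have hyW : y ∈ W := by
    rcases Nat.eq_zero_or_pos r with h | h
    · simpa [h] using hrW
    · exact hmem 0 h
  have hle : W ≤ W.comap T := by
    rw [hWdef, Submodule.span_le]
    rintro _ ⟨i, rfl⟩
    change T (T^[i] y) ∈ W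
    rw [← Function.iterate_succ_apply' T]
    rcases (Nat.succ_le_of_lt i.isLt).lt_or_eq with h | h
    · exact hmem _ h
    · rw [h]
      exact hrW
  have htop := eq_top_of_petitShift_invariant σ a ha m hσ hinj W (fun w hw => hle hw)
    (W.ne_bot_iff.2 ⟨y, hyW, hy⟩)
  have hcard : Module.finrank K W ≤ r := by
    simpa [Set.finrank] using finrank_range_le_card (R := K) fun i : Fin r => T^[i] y
  rw [htop, finrank_top, Module.finrank_fin_fun] at hcard
  exact absurd r.isLt (not_lt.2 hcard)

/-- In a cyclic extension of prime degree, the conjugates of an element outside the base field are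
pairwise distinct. -/
theorem IsGalois.injective_pow_apply_of_prime_finrank {F K : Type*} [Field F] [Field K]
    [Algebra F K] [FiniteDimensional F K] [IsGalois F K] {m : ℕ}
    (hdeg : Module.finrank F K = m) (hm : m.Prime)
    (σ : K ≃ₐ[F] K) (hσ : orderOf σ = m) (a : K) (ha : a ∉ Set.range (algebraMap F K)) :
    Function.Injective fun l : Fin m => (σ ^ (l : ℕ)) a := by
  have hcard : Nat.card (K ≃ₐ[F] K) = m := (IsGalois.card_aut_eq_finrank F K).trans hdeg
  have : Fact (Nat.card (K ≃ₐ[F] K)).Prime := ⟨hcard ▸ hm⟩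
  have hbot : MulAction.stabilizer (K ≃ₐ[F] K) a = ⊥ := by
    refine (Subgroup.eq_bot_or_eq_top_of_prime_card _).resolve_right fun h => ha ?_
    refine (IsGalois.mem_range_algebraMap_iff_fixed a).2 fun τ => ?_
    exact MulAction.mem_stabilizer_iff.1 (h ▸ Subgroup.mem_top τ)
  intro i j hij
  have hstab : (σ ^ (j : ℕ))⁻¹ * σ ^ (i : ℕ) ∈ MulAction.stabilizer (K ≃ₐ[F] K) a := by
    rw [MulAction.mem_stabilizer_iff, mul_smul, inv_smul_eq_iff]
    exact hij
  rw [hbot, Subgroup.mem_bot, inv_mul_eq_one] at hstab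
  exact Fin.ext (pow_injOn_Iio_orderOf (by simp [hσ]) (by simp [hσ]) hstab.symm)

/-- Let `K/F` be cyclic Galois of degree `m` with
`Gal(K/F) = ⟨σ⟩`, and suppose `m = 2`, or `m = 3`, or `m ≥ 5` is prime and `F`
contains a primitive `m`th root of unity. Then for every `a ∈ K ∖ F`, the
nonassociative cyclic algebra `(K/F, σ, a)` is a division algebra (it has no
zero divisors). -/
theorem stmt_19 {F K : Type*} [Field F] [Field K] [Algebra F K]
    [IsGalois F K]
    (m : ℕ) (hdeg : Module.finrank F K = m)
    (hcase : m = 2 ∨ m = 3 ∨ (5 ≤ m ∧ Nat.Prime m ∧ ∃ ζ : F, IsPrimitiveRoot ζ m))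
    (σ : K ≃ₐ[F] K)
    (hgen : ∀ τ : K ≃ₐ[F] K, τ ∈ Subgroup.zpowers σ)
    (a : K) (ha : a ∉ Set.range (algebraMap F K)) :
    ∀ x y : Fin m → K, petitMul σ a m x y = 0 → x = 0 ∨ y = 0 := by
  have hm : m.Prime := by
    rcases hcase with rfl | rfl | ⟨-, h, -⟩
    exacts [Nat.prime_two, Nat.prime_three, h]
  have : NeZero m := ⟨hm.ne_zero⟩
  have : FiniteDimensional F K := Module.finite_of_finrank_pos (hdeg ▸ hm.pos)
  have hord : orderOf σ = m :=
    (orderOf_eq_card_of_forall_mem_zpowers hgen).trans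
      ((IsGalois.card_aut_eq_finrank F K).trans hdeg)
  have ha0 : a ≠ 0 := fun h => ha ⟨0, by rw [h, map_zero]⟩
  exact petitMul_eq_zero_of_injective σ a ha0 m (hord ▸ pow_orderOf_eq_one σ)
    (IsGalois.injective_pow_apply_of_prime_finrank hdeg hm σ hord a ha)
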